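/- For every integer n ≥ 1: the matrix A_n is diagonalizable over ℂ (there exist an invertible matrix P and a diagonal matrix D with A_n = P D P^{−1}), and the kernel {v ∈ ℂ^{2n+4} : A_n v = 0} is two-dimensional, spanned by v₁ + J_n v₁ and v₁ − J_n v₁, where v₁ = e_1 + e_2 + ⋯ + e_n − e_{n+1} − e_{n+2} and e_1, …, e_{2n+4} is the standard basis of ℂ^{2n+4}. -/

import Mathlib

open Matrix

/-- The paired tent map `T_κ : [-1,1] → [-1,1]`. -/
noncomputable def pairedTent (κ : ℝ) (x : ℝ) : ℝ :=
  if x ≤ -(1/2) then 2*(1+κ)*(x+1) - 1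
  else if x < 0 then -(2*(1+κ))*x - 1
  else if x = 0 then 0
  else if x ≤ 1/2 then -(2*(1+κ))*x + 1
  else 2*(1+κ)*(x-1) + 1

/-- The partition points `p_0 < ⋯ < p_{2n+4}` of the Markov partition for `T_{κ_n}`. -/
noncomputable def markovPoint (n : ℕ) (κ : ℝ) (i : ℕ) : ℝ :=
  if i = 0 then -1
  else if i < n then (2 + 2*κ)^i * κ - 1
  else if i = n then -(1/2)
  else if i = n + 1 then -κ
  else if i = n + 2 then 0
  else if i = n + 3 then κ
  else if i = n + 4 then 1/2
  else if i < 2*n + 4 then 1 - (2 + 2*κ)^(2*n + 4 - i) * κ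
  else 1

/-- The interval `R_i = (p_{i-1}, p_i)`, for `1 ≤ i ≤ 2n+4`. -/
noncomputable def markovInterval (n : ℕ) (κ : ℝ) (i : ℕ) : Set ℝ :=
  Set.Ioo (markovPoint n κ (i - 1)) (markovPoint n κ i)

open scoped Classical in
/-- The `(2n+4) × (2n+4)` adjacency matrix `A_n`: the `(i,j)` entry (1-based) is `1`
if `R_i ⊆ T_n(R_j)` and `0` otherwise. -/
noncomputable def Amat (n : ℕ) (κ : ℝ) : Matrix (Fin (2*n + 4)) (Fin (2*n + 4)) ℂ :=
  Matrix.of fun i j =>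
    if markovInterval n κ ((i : ℕ) + 1) ⊆ pairedTent κ '' markovInterval n κ ((j : ℕ) + 1)
    then 1 else 0

/-- The `(2n+4) × (2n+4)` exchange matrix `J_n`: entry `(i,j)` (1-based) is `1` iff
`i + j = 2n+5`. -/
def Jmat (n : ℕ) : Matrix (Fin (2*n + 4)) (Fin (2*n + 4)) ℂ :=
  Matrix.of fun i j => if (i : ℕ) + 1 + ((j : ℕ) + 1) = 2*n + 5 then 1 else 0

/-- The vector `v₁ = e_1 + ⋯ + e_n - e_{n+1} - e_{n+2}` (1-based indices). -/
def kerVec (n : ℕ) : Fin (2*n + 4) → ℂ :=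
  fun j => if (j : ℕ) + 1 ≤ n then 1 else if (j : ℕ) + 1 ≤ n + 2 then -1 else 0


/-! ### Markov points -/

lemma mp_zero (n : ℕ) (κ : ℝ) : markovPoint n κ 0 = -1 := by simp [markovPoint]

lemma mp_mid {n i : ℕ} (κ : ℝ) (h0 : i ≠ 0) (h : i < n) :
    markovPoint n κ i = (2+2*κ)^i * κ - 1 := by
  unfold markovPoint; rw [if_neg h0, if_pos h]

lemma mp_n {n : ℕ} (hn : 1 ≤ n) (κ : ℝ) : markovPoint n κ (n) = -(1/2) := by
  unfold markovPoint
  rw [if_neg (show ¬ (n = 0) by omega), if_neg (show ¬ (n < n) by omega), if_pos (show n = n by omega)]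

lemma mp_n1 {n : ℕ} (κ : ℝ) : markovPoint n κ (n+1) = -κ := by
  unfold markovPoint
  rw [if_neg (show ¬ (n+1 = 0) by omega), if_neg (show ¬ (n+1 < n) by omega), if_neg (show ¬ (n+1 = n) by omega), if_pos (show n+1 = n+1 by omega)]

lemma mp_n2 {n : ℕ} (κ : ℝ) : markovPoint n κ (n+2) = 0 := by
  unfold markovPoint
  rw [if_neg (show ¬ (n+2 = 0) by omega), if_neg (show ¬ (n+2 < n) by omega), if_neg (show ¬ (n+2 = n) by omega), if_neg (show ¬ (n+2 = n+1) by omega), if_pos (show n+2 = n+2 by omega)]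

lemma mp_n3 {n : ℕ} (κ : ℝ) : markovPoint n κ (n+3) = κ := by
  unfold markovPoint
  rw [if_neg (show ¬ (n+3 = 0) by omega), if_neg (show ¬ (n+3 < n) by omega), if_neg (show ¬ (n+3 = n) by omega), if_neg (show ¬ (n+3 = n+1) by omega), if_neg (show ¬ (n+3 = n+2) by omega), if_pos (show n+3 = n+3 by omega)]

lemma mp_n4 {n : ℕ} (κ : ℝ) : markovPoint n κ (n+4) = 1/2 := by
  unfold markovPoint
  rw [if_neg (show ¬ (n+4 = 0) by omega), if_neg (show ¬ (n+4 < n) by omega), if_neg (show ¬ (n+4 = n) by omega), if_neg (show ¬ (n+4 = n+1) by omega), if_neg (show ¬ (n+4 = n+2) by omega), if_neg (show ¬ (n+4 = n+3) by omega), if_pos (show n+4 = n+4 by omega)]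

lemma mp_right {n : ℕ} {i : ℕ} (h : n + 4 < i) (h' : i < 2*n+4) (κ : ℝ) : markovPoint n κ (i) = 1 - (2 + 2*κ)^(2*n+4-i) * κ := by
  unfold markovPoint
  rw [if_neg (show ¬ (i = 0) by omega), if_neg (show ¬ (i < n) by omega), if_neg (show ¬ (i = n) by omega), if_neg (show ¬ (i = n+1) by omega), if_neg (show ¬ (i = n+2) by omega), if_neg (show ¬ (i = n+3) by omega), if_neg (show ¬ (i = n+4) by omega), if_pos (show i < 2*n+4 by omega)]

lemma mp_last {n : ℕ} (hn : 1 ≤ n) (κ : ℝ) : markovPoint n κ (2*n+4) = 1 := by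
  unfold markovPoint
  rw [if_neg (show ¬ (2*n+4 = 0) by omega), if_neg (show ¬ (2*n+4 < n) by omega), if_neg (show ¬ (2*n+4 = n) by omega), if_neg (show ¬ (2*n+4 = n+1) by omega), if_neg (show ¬ (2*n+4 = n+2) by omega), if_neg (show ¬ (2*n+4 = n+3) by omega), if_neg (show ¬ (2*n+4 = n+4) by omega), if_neg (show ¬ (2*n+4 < 2*n+4) by omega)]

lemma mp_symm_left (n : ℕ) (hn : 1 ≤ n) (κ : ℝ) (i : ℕ) (hi : i ≤ n+2) :
    markovPoint n κ (2*n+4-i) = - markovPoint n κ i := by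
  have hc : i = 0 ∨ (i ≠ 0 ∧ i < n) ∨ i = n ∨ i = n+1 ∨ i = n+2 := by omega
  rcases hc with h | ⟨h0, h⟩ | h | h | h
  · subst h; rw [Nat.sub_zero, mp_zero, mp_last hn]; ring
  · rw [mp_mid κ h0 h, mp_right (by omega) (by omega)]
    rw [show 2*n+4-(2*n+4-i) = i by omega]; ring
  · subst h; rw [show 2*i+4-i = i+4 by omega, mp_n4, mp_n hn]; ring
  · subst h; rw [show 2*n+4-(n+1) = n+3 by omega, mp_n3, mp_n1]; ring
  · subst h; rw [show 2*n+4-(n+2) = n+2 by omega, mp_n2]; ring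

lemma mp_symm (n : ℕ) (hn : 1 ≤ n) (κ : ℝ) (i : ℕ) (hi : i ≤ 2*n+4) :
    markovPoint n κ (2*n+4-i) = - markovPoint n κ i := by
  rcases Nat.lt_or_ge i (n+2) with h | h
  · exact mp_symm_left n hn κ i h.le
  · have := mp_symm_left n hn κ (2*n+4-i) (by omega)
    rw [show 2*n+4-(2*n+4-i) = i by omega] at this
    rw [this]; ring

lemma pow_small {n : ℕ} {κ : ℝ} (hκ : κ ∈ Set.Ioo (0 : ℝ) (1/2)) (heq : (2 + 2*κ)^n * κ = 1)
    {i : ℕ} (hi : i < n) : (2+2*κ)^i * κ < 1/2 := by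
  obtain ⟨h0, h1⟩ := hκ
  have h : (2+2*κ)^(i+1) ≤ (2+2*κ)^n := pow_le_pow_right₀ (by linarith) hi
  have h2 : (2+2*κ)^(i+1) * κ ≤ 1 := by
    rw [← heq]; exact mul_le_mul_of_nonneg_right h h0.le
  have h3 : 0 < (2+2*κ)^i * κ := by positivity
  rw [pow_succ] at h2
  nlinarith

lemma mp_step_left {n : ℕ} (hn : 1 ≤ n) {κ : ℝ} (hκ : κ ∈ Set.Ioo (0 : ℝ) (1/2))
    (heq : (2 + 2*κ)^n * κ = 1) (i : ℕ) (hi : i < n+2) :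
    markovPoint n κ i < markovPoint n κ (i+1) := by
  have h0 := hκ.1
  have h1 := hκ.2
  have hlt : ∀ j, j < n → (2+2*κ)^j * κ < 1/2 := fun j hj => pow_small hκ heq hj
  have hpos : ∀ j, 0 < (2+2*κ)^j * κ := fun j => by positivity
  have hss : (2+2*κ)^i * κ < (2+2*κ)^(i+1) * κ := by
    rw [pow_succ]; nlinarith [hpos i]
  have hc : (i = 0 ∧ n = 1) ∨ (i = 0 ∧ 1 < n) ∨ (i ≠ 0 ∧ i + 1 < n) ∨ (i ≠ 0 ∧ i + 1 = n) ∨ i = n ∨ i = n+1 := by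
    omega
  rcases hc with ⟨h, h'⟩ | ⟨h, h'⟩ | ⟨h, h'⟩ | ⟨h, h'⟩ | h | h
  · subst h; subst h'; rw [mp_zero, mp_n le_rfl]; norm_num
  · subst h; rw [mp_zero, mp_mid κ (by omega) (by omega)]; linarith [hpos (0+1)]
  · rw [mp_mid κ h (by omega), mp_mid κ (by omega) h']; linarith
  · rw [mp_mid κ h (by omega), h', mp_n hn]; linarith [hlt i (by omega)]
  · subst h; rw [mp_n hn, mp_n1]; linarith
  · subst h; rw [mp_n1, mp_n2]; linarith

lemma mp_step {n : ℕ} (hn : 1 ≤ n) {κ : ℝ} (hκ : κ ∈ Set.Ioo (0 : ℝ) (1/2))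
    (heq : (2 + 2*κ)^n * κ = 1) (i : ℕ) (hi : i < 2*n+4) :
    markovPoint n κ i < markovPoint n κ (i+1) := by
  rcases Nat.lt_or_ge i (n+2) with h | h
  · exact mp_step_left hn hκ heq i h
  · have a := mp_step_left hn hκ heq (2*n+4-(i+1)) (by omega)
    have e : 2*n+4-(i+1)+1 = 2*n+4-i := by omega
    rw [e, mp_symm n hn κ _ (by omega), mp_symm n hn κ _ (by omega)] at a
    linarith

lemma mp_lt {n : ℕ} (hn : 1 ≤ n) {κ : ℝ} (hκ : κ ∈ Set.Ioo (0 : ℝ) (1/2))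
    (heq : (2 + 2*κ)^n * κ = 1) (i j : ℕ) (hij : i < j) (hj : j ≤ 2*n+4) :
    markovPoint n κ i < markovPoint n κ j := by
  induction j with
  | zero => omega
  | succ j ih =>
    have s := mp_step hn hκ heq j (by omega)
    rcases Nat.lt_or_ge i j with h | h
    · exact (ih h (by omega)).trans s
    · have : i = j := by omega
      subst this; exact s

lemma mp_le_iff {n : ℕ} (hn : 1 ≤ n) {κ : ℝ} (hκ : κ ∈ Set.Ioo (0 : ℝ) (1/2))
    (heq : (2 + 2*κ)^n * κ = 1) (i j : ℕ) (hi : i ≤ 2*n+4) (hj : j ≤ 2*n+4) :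
    markovPoint n κ i ≤ markovPoint n κ j ↔ i ≤ j := by
  constructor
  · intro h
    by_contra hc
    exact absurd (mp_lt hn hκ heq j i (by omega) hi) (not_lt.mpr h)
  · intro h
    rcases Nat.lt_or_ge i j with h' | h'
    · exact (mp_lt hn hκ heq i j h' hj).le
    · have : i = j := by omega
      rw [this]

/-! ### The induced map on indices of partition points -/

/-- index of the image of the point `p_i`, for `i ≤ n+1`. -/
def sg (n i : ℕ) : ℕ :=
  if i = 0 then 0
  else if i + 1 < n then i + 1
  else if i + 1 = n then n + 2
  else if i = n then n + 3
  else if 1 < n then 1 else n + 2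

/-- lower end of the image of `R_{j+1}` -/
def lo (n j : ℕ) : ℕ := if j < n then sg n j else if j = n then sg n (n+1) else 0

/-- upper end of the image of `R_{j+1}` -/
def hi (n j : ℕ) : ℕ := if j < n then sg n (j+1) else if j = n then n+3 else sg n (n+1)

lemma mp_sg {n : ℕ} (hn : 1 ≤ n) {κ : ℝ}
    (heq : (2 + 2*κ)^n * κ = 1) (i : ℕ) (hi : i ≤ n) :
    markovPoint n κ (sg n i) = 2*(1+κ)*(markovPoint n κ i + 1) - 1 := by
  unfold sg
  split_ifs with h0 h1 h2 h3 h4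
  · subst h0; rw [mp_zero]; ring
  · rw [mp_mid κ (by omega) h1, mp_mid κ h0 (by omega)]; ring
  · rw [mp_n2, mp_mid κ h0 (by omega)]
    rw [← h2] at heq
    rw [pow_succ] at heq; linarith
  · subst h3; rw [mp_n3, mp_n hn]; ring
  · omega
  · omega

lemma mp_sg1 {n : ℕ} (hn : 1 ≤ n) {κ : ℝ} (heq : (2 + 2*κ)^n * κ = 1) :
    markovPoint n κ (sg n (n+1)) = (2 + 2*κ)*κ - 1 := by
  have e : sg n (n+1) = if 1 < n then 1 else n + 2 := by
    unfold sg
    rw [if_neg (by omega), if_neg (by omega), if_neg (by omega), if_neg (by omega)]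
  rw [e]
  split_ifs with h
  · rw [mp_mid κ (by omega) h]; ring
  · have : n = 1 := by omega
    subst this
    rw [mp_n2]; rw [pow_one] at heq; linarith

lemma image_incr (κ a b : ℝ) (hκ : 0 < κ) (hb : b ≤ -(1/2)) :
    pairedTent κ '' Set.Ioo a b = Set.Ioo (2*(1+κ)*(a+1) - 1) (2*(1+κ)*(b+1) - 1) := by
  ext y
  constructor
  · rintro ⟨x, ⟨h1, h2⟩, rfl⟩
    unfold pairedTent
    rw [if_pos (by linarith)]
    constructor <;> nlinarith
  · rintro ⟨h1, h2⟩
    have hs : 0 < 2*(1+κ) := by linarith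
    have e : 2*(1+κ)*((y+1)/(2*(1+κ))) = y+1 := by field_simp
    have a1 : a < (y+1)/(2*(1+κ)) - 1 := by nlinarith
    have a2 : (y+1)/(2*(1+κ)) - 1 < b := by nlinarith
    refine ⟨(y+1)/(2*(1+κ)) - 1, ⟨a1, a2⟩, ?_⟩
    unfold pairedTent
    rw [if_pos (by linarith)]
    linarith

lemma image_decr (κ a b : ℝ) (hκ : 0 < κ) (ha : -(1/2) ≤ a) (hb : b ≤ 0) :
    pairedTent κ '' Set.Ioo a b = Set.Ioo (-(2*(1+κ))*b - 1) (-(2*(1+κ))*a - 1) := by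
  ext y
  constructor
  · rintro ⟨x, ⟨h1, h2⟩, rfl⟩
    unfold pairedTent
    rw [if_neg (by linarith), if_pos (by linarith)]
    constructor <;> nlinarith
  · rintro ⟨h1, h2⟩
    have hs : 0 < 2*(1+κ) := by linarith
    have e : 2*(1+κ)*((y+1)/(2*(1+κ))) = y+1 := by field_simp
    have a1 : a < -((y+1)/(2*(1+κ))) := by nlinarith
    have a2 : -((y+1)/(2*(1+κ))) < b := by nlinarith
    refine ⟨-((y+1)/(2*(1+κ))), ⟨a1, a2⟩, ?_⟩
    unfold pairedTent
    rw [if_neg (by linarith), if_pos (by linarith)]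
    linarith

lemma image_left {n : ℕ} (hn : 1 ≤ n) {κ : ℝ} (hκ : κ ∈ Set.Ioo (0 : ℝ) (1/2))
    (heq : (2 + 2*κ)^n * κ = 1) (j : ℕ) (hj : j < n+2) :
    pairedTent κ '' Set.Ioo (markovPoint n κ j) (markovPoint n κ (j+1)) =
      Set.Ioo (markovPoint n κ (lo n j)) (markovPoint n κ (hi n j)) := by
  unfold lo hi
  split_ifs with h1 h2
  · rw [image_incr κ _ _ hκ.1, mp_sg hn heq j (by omega), mp_sg hn heq (j+1) (by omega)]
    rw [← mp_n hn κ, mp_le_iff hn hκ heq _ _ (by omega) (by omega)]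
    omega
  · subst h2
    rw [mp_n hn, mp_n1, mp_n3, mp_sg1 hn heq, image_decr κ _ _ hκ.1 le_rfl (by linarith [hκ.1])]
    congr 1 <;> ring
  · have : j = n+1 := by omega
    subst this
    rw [mp_n1, mp_n2, mp_zero, mp_sg1 hn heq, image_decr κ _ _ hκ.1 (by linarith [hκ.2]) le_rfl]
    congr 1 <;> ring

lemma hi_le {n : ℕ} (_hn : 1 ≤ n) (j : ℕ) : hi n j ≤ n + 3 := by
  unfold hi sg; split_ifs <;> first | contradiction | omega

lemma lo_le {n : ℕ} (hn : 1 ≤ n) (j : ℕ) : lo n j ≤ n + 3 := by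
  unfold lo sg; split_ifs <;> first | contradiction | omega

lemma lo_le_hi {n : ℕ} (hn : 1 ≤ n) (j : ℕ) : lo n j ≤ hi n j := by
  unfold lo hi sg; split_ifs <;> first | contradiction | omega

lemma hi_ne {n : ℕ} (hn : 1 ≤ n) (j : ℕ) : hi n j ≠ n := by
  unfold hi sg; split_ifs <;> first | contradiction | omega

lemma lo_ne {n : ℕ} (hn : 1 ≤ n) (j : ℕ) : lo n j ≠ n := by
  unfold lo sg; split_ifs <;> first | contradiction | omega

lemma Amat_left {n : ℕ} (hn : 1 ≤ n) {κ : ℝ} (hκ : κ ∈ Set.Ioo (0 : ℝ) (1/2))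
    (heq : (2 + 2*κ)^n * κ = 1) (i j : Fin (2*n+4)) (hj : (j : ℕ) < n+2) :
    Amat n κ i j = if lo n j ≤ i ∧ (i : ℕ) < hi n j then 1 else 0 := by
  have hi2 := i.2
  have a := hi_le hn (j : ℕ)
  have b := lo_le hn (j : ℕ)
  have key : markovInterval n κ ((i : ℕ) + 1) ⊆ pairedTent κ '' markovInterval n κ ((j : ℕ) + 1) ↔
      lo n j ≤ i ∧ (i : ℕ) < hi n j := by
    unfold markovInterval
    rw [Nat.add_sub_cancel, Nat.add_sub_cancel, image_left hn hκ heq j hj,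
      Set.Ioo_subset_Ioo_iff (mp_step hn hκ heq i i.2),
      mp_le_iff hn hκ heq _ _ (by omega) (by omega), mp_le_iff hn hκ heq _ _ (by omega) (by omega),
      Nat.succ_le_iff]
  unfold Amat
  rw [Matrix.of_apply]
  by_cases h : lo n j ≤ i ∧ (i : ℕ) < hi n j
  · rw [if_pos h, if_pos (key.mpr h)]
  · rw [if_neg h, if_neg (fun h' => h (key.mp h'))]

lemma pairedTent_neg (κ x : ℝ) : pairedTent κ (-x) = - pairedTent κ x := by
  have key : ∀ y : ℝ, 0 < y → pairedTent κ (-y) = - pairedTent κ y := by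
    intro y hy
    unfold pairedTent
    rcases lt_trichotomy y (1/2) with h | h | h
    · rw [if_neg (by linarith), if_pos (by linarith), if_neg (by linarith), if_neg (by linarith),
        if_neg (by linarith), if_pos (by linarith)]
      ring
    · subst h; norm_num; ring
    · rw [if_pos (by linarith), if_neg (by linarith), if_neg (by linarith),
        if_neg (by linarith), if_neg (by linarith)]
      ring
  rcases lt_trichotomy x 0 with h | h | h
  · have := key (-x) (by linarith)
    rw [neg_neg] at this
    rw [this, neg_neg]
  · subst h
    unfold pairedTent; norm_num
  · exact key x h

lemma rev_val {n : ℕ} (i : Fin (2*n+4)) : ((Fin.rev i : Fin (2*n+4)) : ℕ) = 2*n+4-((i:ℕ)+1) := by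
  rw [Fin.val_rev]

lemma interval_rev {n : ℕ} (hn : 1 ≤ n) (κ : ℝ) (i : Fin (2*n+4)) :
    markovInterval n κ ((Fin.rev i : Fin (2*n+4)) + 1 : ℕ) =
      Neg.neg '' markovInterval n κ ((i : ℕ) + 1) := by
  have := i.2
  unfold markovInterval
  simp only [Nat.add_sub_cancel_right, rev_val]
  have e : 2*n+4-((i:ℕ)+1)+1 = 2*n+4-i := by omega
  rw [e, mp_symm n hn κ _ (by omega), mp_symm n hn κ _ (by omega)]
  simp

lemma Amat_rev {n : ℕ} (hn : 1 ≤ n) (κ : ℝ) (i j : Fin (2*n+4)) :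
    Amat n κ (Fin.rev i) (Fin.rev j) = Amat n κ i j := by
  unfold Amat
  simp only [Matrix.of_apply]
  congr 1
  rw [interval_rev hn, interval_rev hn]
  have : pairedTent κ '' (Neg.neg '' markovInterval n κ ((j:ℕ)+1)) =
      Neg.neg '' (pairedTent κ '' markovInterval n κ ((j:ℕ)+1)) := by
    rw [Set.image_image, Set.image_image]
    simp only [pairedTent_neg]
  rw [this, Set.image_subset_image_iff neg_injective]

/-! ### Left eigenvectors -/

/-- values at the left partition points of the primitive of a left eigenvector -/
noncomputable def Lf (n : ℕ) (l e : ℂ) (i : ℕ) : ℂ :=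
  if i = 0 then 0
  else if i < n then l^i
  else if i = n then (l^n + e)/l
  else if i = n+1 then l^n - 1
  else l^n

/-- primitive of a left eigenvector -/
noncomputable def Wf (n : ℕ) (l e : ℂ) (i : ℕ) : ℂ :=
  if i ≤ n+2 then Lf n l e i else l^n + e * (l^n - Lf n l e (2*n+4-i))

/-- left eigenvector -/
noncomputable def wv (n : ℕ) (l e : ℂ) (i : Fin (2*n+4)) : ℂ :=
  Wf n l e ((i:ℕ)+1) - Wf n l e i

lemma Wf_zero (n : ℕ) (l e : ℂ) : Wf n l e 0 = 0 := by simp [Wf, Lf]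

lemma Wf_mid {n i : ℕ} (l e : ℂ) (h0 : i ≠ 0) (h : i < n) : Wf n l e i = l^i := by
  unfold Wf Lf; rw [if_pos (by omega), if_neg h0, if_pos h]

lemma Wf_n {n : ℕ} (hn : 1 ≤ n) (l e : ℂ) : Wf n l e n = (l^n+e)/l := by
  unfold Wf Lf; rw [if_pos (by omega), if_neg (by omega), if_neg (by omega), if_pos rfl]

lemma Wf_n1 (n : ℕ) (l e : ℂ) : Wf n l e (n+1) = l^n - 1 := by
  unfold Wf Lf
  rw [if_pos (by omega), if_neg (by omega), if_neg (by omega), if_neg (by omega), if_pos rfl]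

lemma Wf_n2 (n : ℕ) (l e : ℂ) : Wf n l e (n+2) = l^n := by
  unfold Wf Lf
  rw [if_pos (by omega), if_neg (by omega), if_neg (by omega), if_neg (by omega),
    if_neg (by omega)]

lemma Wf_n3 (n : ℕ) (l e : ℂ) : Wf n l e (n+3) = l^n + e := by
  unfold Wf Lf
  rw [if_neg (by omega), if_neg (by omega), if_neg (by omega), if_neg (by omega),
    if_pos (by omega)]
  ring

lemma Wf_refl {n : ℕ} (l e : ℂ) (he : e^2 = 1) (i : ℕ) (hi : i ≤ 2*n+4) :
    Wf n l e (2*n+4-i) = l^n + e * (l^n - Wf n l e i) := by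
  rcases lt_trichotomy i (n+2) with h | h | h
  · have e1 : Wf n l e i = Lf n l e i := by unfold Wf; rw [if_pos (by omega)]
    rw [e1]; unfold Wf
    rw [if_neg (by omega), show 2*n+4-(2*n+4-i) = i by omega]
  · subst h
    rw [show 2*n+4-(n+2) = n+2 by omega, Wf_n2]; ring
  · have e1 : Wf n l e i = l^n + e * (l^n - Lf n l e (2*n+4-i)) := by
      unfold Wf; rw [if_neg (by omega)]
    rw [e1]; unfold Wf
    rw [if_pos (by omega)]
    linear_combination (l^n - Lf n l e (2*n+4-i)) * he

lemma wv_rev {n : ℕ} (l e : ℂ) (he : e^2 = 1) (i : Fin (2*n+4)) :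
    wv n l e (Fin.rev i) = e * wv n l e i := by
  have := i.2
  unfold wv
  rw [rev_val, show 2*n+4-((i:ℕ)+1)+1 = 2*n+4-i by omega, Wf_refl l e he _ (by omega),
    Wf_refl l e he _ (by omega)]
  ring

lemma Wf_sg {n : ℕ} (hn : 1 ≤ n) {l e : ℂ} (hl : l ≠ 0) (i : ℕ) (hi : i ≤ n) :
    Wf n l e (sg n i) = l * Wf n l e i := by
  unfold sg
  split_ifs with h0 h1 h2 h3 h4
  · subst h0; rw [Wf_zero]; ring
  · rw [Wf_mid _ _ (by omega) h1, Wf_mid _ _ h0 (by omega)]; ring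
  · rw [Wf_n2, Wf_mid _ _ h0 (by omega), ← h2]; ring
  · subst h3; rw [Wf_n3, Wf_n hn]; field_simp
  · omega
  · omega

lemma sg_n1 (n : ℕ) : sg n (n+1) = if 1 < n then 1 else n + 2 := by
  unfold sg
  rw [if_neg (by omega), if_neg (by omega), if_neg (by omega), if_neg (by omega)]

lemma Wf_sg1 {n : ℕ} (hn : 1 ≤ n) (l e : ℂ) : Wf n l e (sg n (n+1)) = l := by
  rw [sg_n1]
  split_ifs with h
  · rw [Wf_mid _ _ (by omega) h]; ring
  · have : n = 1 := by omega
    subst this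
    rw [Wf_n2]; ring

lemma Wf_lohi {n : ℕ} (hn : 1 ≤ n) {l e : ℂ} (hl : l ≠ 0) (hle : l^n*(l-2) = 2*e)
    (j : ℕ) (hj : j < n+2) :
    Wf n l e (hi n j) - Wf n l e (lo n j) = l * (Wf n l e (j+1) - Wf n l e j) := by
  unfold lo hi
  split_ifs with h1 h2
  · rw [Wf_sg hn hl _ (by omega), Wf_sg hn hl _ (by omega)]; ring
  · subst h2
    rw [Wf_sg1 hn, Wf_n hn, Wf_n1, Wf_n3]
    field_simp
    linear_combination -hle
  · have : j = n+1 := by omega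
    subst this
    rw [Wf_n1, Wf_n2, Wf_zero, Wf_sg1 hn]; ring

/-- telescoping sum over an index window -/
lemma sum_window (N a b : ℕ) (hab : a ≤ b) (hb : b ≤ N) (F : ℕ → ℂ) :
    ∑ i : Fin N, (F ((i:ℕ)+1) - F i) * (if a ≤ (i:ℕ) ∧ (i:ℕ) < b then (1:ℂ) else 0)
      = F b - F a := by
  rw [Fin.sum_univ_eq_sum_range
    (fun i => (F (i+1) - F i) * (if a ≤ i ∧ i < b then (1:ℂ) else 0)) N]
  simp only [mul_ite, mul_one, mul_zero]
  rw [← Finset.sum_filter]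
  have : (Finset.range N).filter (fun i => a ≤ i ∧ i < b) = Finset.Ico a b := by
    ext i; simp; omega
  rw [this, Finset.sum_Ico_sub F hab]

lemma left_eig {n : ℕ} (hn : 1 ≤ n) {κ : ℝ} (hκ : κ ∈ Set.Ioo (0 : ℝ) (1/2))
    (heq : (2 + 2*κ)^n * κ = 1) {l e : ℂ} (hl : l ≠ 0) (he : e^2 = 1)
    (hle : l^n*(l-2) = 2*e) :
    wv n l e ᵥ* Amat n κ = l • wv n l e := by
  have left : ∀ j : Fin (2*n+4), (j:ℕ) < n+2 →
      ∑ i, wv n l e i * Amat n κ i j = l * wv n l e j := by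
    intro j hj
    have a := hi_le hn (j:ℕ)
    simp only [Amat_left hn hκ heq _ j hj]
    unfold wv
    rw [sum_window (2*n+4) (lo n j) (hi n j) (lo_le_hi hn _) (by omega) (Wf n l e),
      Wf_lohi hn hl hle _ hj]
  ext j
  simp only [Matrix.vecMul, dotProduct, Pi.smul_apply, smul_eq_mul]
  rcases Nat.lt_or_ge (j:ℕ) (n+2) with h | h
  · exact left j h
  · have := left (Fin.rev j) (by rw [rev_val]; omega)
    rw [← Equiv.sum_comp Fin.revPerm] at this
    simp only [Fin.revPerm_apply, Amat_rev hn, wv_rev l e he] at this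
    simp only [mul_assoc] at this
    rw [← Finset.mul_sum] at this
    linear_combination e * this + (l * wv n l e j - ∑ i, wv n l e i * Amat n κ i j) * he

lemma wv_ne {n : ℕ} (l e : ℂ) : wv n l e ≠ 0 := by
  intro h
  have := congrFun h ⟨n+1, by omega⟩
  simp only [wv, Wf_n1, Wf_n2, Pi.zero_apply] at this
  norm_num at this

/-! ### Left kernel -/

/-- left kernel vector -/
noncomputable def k1 (n : ℕ) (hn : 1 ≤ n) : Fin (2*n+4) → ℂ :=
  Pi.single ⟨n-1, by omega⟩ 1 - Pi.single ⟨n, by omega⟩ 1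

/-- mirrored left kernel vector -/
noncomputable def k2 (n : ℕ) (hn : 1 ≤ n) : Fin (2*n+4) → ℂ :=
  Pi.single (Fin.rev ⟨n-1, by omega⟩) 1 - Pi.single (Fin.rev ⟨n, by omega⟩) 1

lemma rows_eq {n : ℕ} (hn : 1 ≤ n) {κ : ℝ} (hκ : κ ∈ Set.Ioo (0 : ℝ) (1/2))
    (heq : (2 + 2*κ)^n * κ = 1) (j : Fin (2*n+4)) :
    Amat n κ ⟨n-1, by omega⟩ j = Amat n κ ⟨n, by omega⟩ j := by
  rcases Nat.lt_or_ge (j:ℕ) (n+2) with h | h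
  · rw [Amat_left hn hκ heq _ j h, Amat_left hn hκ heq _ j h]
    have a := hi_ne hn (j:ℕ)
    have b := lo_ne hn (j:ℕ)
    refine if_congr ?_ rfl rfl
    simp only
    omega
  · rw [← Amat_rev hn κ _ j, ← Amat_rev hn κ ⟨n, _⟩ j]
    have h' : ((Fin.rev j : Fin (2*n+4)) : ℕ) < n+2 := by rw [rev_val]; omega
    rw [Amat_left hn hκ heq _ _ h', Amat_left hn hκ heq _ _ h']
    have a := hi_le hn ((Fin.rev j : Fin (2*n+4)) : ℕ)
    rw [if_neg, if_neg]
    · simp only [rev_val] at *; omega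
    · simp only [rev_val] at *; omega

lemma k1_ker {n : ℕ} (hn : 1 ≤ n) {κ : ℝ} (hκ : κ ∈ Set.Ioo (0 : ℝ) (1/2))
    (heq : (2 + 2*κ)^n * κ = 1) : k1 n hn ᵥ* Amat n κ = 0 := by
  ext j
  unfold k1
  rw [Matrix.sub_vecMul, Matrix.single_one_vecMul, Matrix.single_one_vecMul]
  simp [rows_eq hn hκ heq j]

lemma k2_ker {n : ℕ} (hn : 1 ≤ n) {κ : ℝ} (hκ : κ ∈ Set.Ioo (0 : ℝ) (1/2))
    (heq : (2 + 2*κ)^n * κ = 1) : k2 n hn ᵥ* Amat n κ = 0 := by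
  ext j
  unfold k2
  rw [Matrix.sub_vecMul, Matrix.single_one_vecMul, Matrix.single_one_vecMul]
  have a := rows_eq hn hκ heq (Fin.rev j)
  rw [← Amat_rev hn κ _ (Fin.rev j), ← Amat_rev hn κ ⟨n, _⟩ (Fin.rev j), Fin.rev_rev] at a
  simp [a]

/-! ### Right kernel -/

lemma Jv {n : ℕ} (v : Fin (2*n+4) → ℂ) : (Jmat n).mulVec v = fun i => v (Fin.rev i) := by
  ext i
  simp only [Matrix.mulVec, dotProduct, Jmat, Matrix.of_apply]
  rw [Finset.sum_eq_single (Fin.rev i)]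
  · rw [if_pos, one_mul]
    rw [rev_val]; omega
  · intro j _ hj
    rw [if_neg, zero_mul]
    intro h
    apply hj
    apply Fin.ext
    rw [rev_val]; omega
  · simp

lemma sg_le_succ {n : ℕ} (hn : 1 ≤ n) (j : ℕ) (hj : j < n) : sg n j ≤ sg n (j+1) := by
  unfold sg; split_ifs <;> first | contradiction | omega

lemma right_ker {n : ℕ} (hn : 1 ≤ n) {κ : ℝ} (hκ : κ ∈ Set.Ioo (0 : ℝ) (1/2))
    (heq : (2 + 2*κ)^n * κ = 1) : (Amat n κ).mulVec (kerVec n) = 0 := by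
  ext i
  simp only [Matrix.mulVec, dotProduct, Pi.zero_apply]
  -- primitive along the columns
  set G : ℕ → ℂ := fun j =>
    if j ≤ n then (if (i:ℕ) < sg n j then 1 else 0)
    else if j = n+1 then (if (i:ℕ) < sg n (n+1) then 1 else 0) else 0 with hG
  have h1 : ∀ j : Fin (2*n+4), Amat n κ i j * kerVec n j =
      (G ((j:ℕ)+1) - G j) * (if 0 ≤ (j:ℕ) ∧ (j:ℕ) < n+2 then (1:ℂ) else 0) := by
    intro j
    rcases Nat.lt_or_ge (j:ℕ) (n+2) with h | h
    · rw [Amat_left hn hκ heq i j h, if_pos (show 0 ≤ (j:ℕ) ∧ (j:ℕ) < n+2 from ⟨Nat.zero_le _, h⟩), mul_one]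
      simp only [hG, kerVec]
      have hc : (j:ℕ) < n ∨ (j:ℕ) = n ∨ (j:ℕ) = n+1 := by omega
      rcases hc with hc | hc | hc
      · have s := sg_le_succ hn (j:ℕ) hc
        rw [if_pos (by omega : (j:ℕ)+1 ≤ n), if_pos (by omega : (j:ℕ)+1 ≤ n),
          if_pos (by omega : (j:ℕ) ≤ n), mul_one]
        unfold lo hi
        rw [if_pos hc, if_pos hc]
        split_ifs <;> first | omega | norm_num
      · have sn : sg n n = n+3 := by
          unfold sg; split_ifs <;> first | contradiction | omega
        have sm : sg n (n+1) ≤ n+3 := by rw [sg_n1]; split_ifs <;> omega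
        rw [hc]
        unfold lo hi
        simp only [lt_irrefl, if_false, if_true, le_refl, sn]
        rw [if_neg (by omega : ¬ (n+1 ≤ n)), if_pos (by omega : n+1 ≤ n+2)]
        split_ifs <;> first | omega | norm_num
      · rw [hc]
        unfold lo hi
        rw [if_neg (by omega : ¬ (n+1 < n)), if_neg (by omega : ¬ (n+1 = n)),
          if_neg (by omega : ¬ (n+1 < n)), if_neg (by omega : ¬ (n+1 = n)),
          if_neg (by omega : ¬ (n+1+1 ≤ n)), if_pos (by omega : n+1+1 ≤ n+2),
          if_neg (by omega : ¬ (n+1+1 ≤ n)), if_neg (by omega : ¬ (n+1+1 = n+1)),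
          if_neg (by omega : ¬ (n+1 ≤ n)), if_pos rfl]
        split_ifs <;> first | omega | norm_num
    · rw [if_neg (by omega)]
      unfold kerVec
      rw [if_neg (by omega), if_neg (by omega)]; ring
  rw [Finset.sum_congr rfl (fun j _ => h1 j), sum_window (2*n+4) 0 (n+2) (by omega) (by omega) G]
  simp [hG, sg]

lemma right_ker_J {n : ℕ} (hn : 1 ≤ n) {κ : ℝ} (hκ : κ ∈ Set.Ioo (0 : ℝ) (1/2))
    (heq : (2 + 2*κ)^n * κ = 1) : (Amat n κ).mulVec ((Jmat n).mulVec (kerVec n)) = 0 := by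
  rw [Jv]
  ext i
  have := congrFun (right_ker hn hκ heq) (Fin.rev i)
  simp only [Matrix.mulVec, dotProduct, Pi.zero_apply] at this ⊢
  rw [← Equiv.sum_comp Fin.revPerm] at this
  simpa only [Fin.revPerm_apply, Amat_rev hn] using this

/-! ### The polynomial of nonzero eigenvalues -/

open Polynomial in
/-- polynomial whose roots are the nonzero eigenvalues -/
noncomputable def qp (n : ℕ) : ℂ[X] := (X^n * (X - C 2))^2 - C 4

open Polynomial in
lemma qp_deg (n : ℕ) : (qp n).natDegree = 2*n+2 := by
  have hm : (X^n * (X - C (2:ℂ))).Monic := (monic_X_pow n).mul (monic_X_sub_C 2)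
  have hd : (X^n * (X - C (2:ℂ))).natDegree = n+1 := by
    rw [(monic_X_pow n).natDegree_mul (monic_X_sub_C 2)]; simp
  unfold qp
  rw [natDegree_sub_C, hm.natDegree_pow, hd]; ring

lemma nat_ne (n : ℕ) (hn : 1 ≤ n) : (2*n)^n ≠ (n+1)^(n+1) := by
  intro h
  have h1 : n ∣ (n+1)^(n+1) := by
    rw [← h]; exact dvd_pow (Dvd.intro_left 2 rfl) (by omega)
  have hc : Nat.Coprime n ((n+1)^(n+1)) := by
    apply Nat.Coprime.pow_right
    simp
  have : n = 1 := Nat.Coprime.eq_one_of_dvd hc h1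
  subst this
  norm_num at h

open Polynomial in
lemma qp_no_double (n : ℕ) (hn : 1 ≤ n) (z : ℂ) (h1 : (qp n).IsRoot z)
    (h2 : (derivative (qp n)).IsRoot z) : False := by
  obtain ⟨m, rfl⟩ : ∃ m, n = m+1 := ⟨n-1, by omega⟩
  unfold qp at h1 h2
  simp only [IsRoot.def, eval_sub, eval_pow, eval_mul, eval_X, eval_C] at h1
  simp only [derivative_sub, derivative_pow, derivative_mul, derivative_X, derivative_C,
    IsRoot.def, eval_sub, eval_pow, eval_mul, eval_X, eval_C, eval_add, Nat.add_sub_cancel,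
    eval_zero, eval_one] at h2
  have hz : z ≠ 0 := by
    rintro rfl
    norm_num at h1
  have hz2 : z - 2 ≠ 0 := by
    intro h
    rw [h] at h1
    norm_num at h1
  have hzm : z^m ≠ 0 := pow_ne_zero _ hz
  have hlin : ((m:ℂ)+2) * z = 2*(m+1) := by
    have : (2 * z^(m+1) * (z-2) * z^m) * (((m:ℂ)+2) * z - 2*(m+1)) = 0 := by
      push_cast at h2
      linear_combination h2
    have h3 : 2 * z^(m+1) * (z-2) * z^m ≠ 0 :=
      mul_ne_zero (mul_ne_zero (mul_ne_zero two_ne_zero (pow_ne_zero _ hz)) hz2) hzm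
    have := (mul_eq_zero.mp this).resolve_left h3
    linear_combination this
  have hl2 : ((m:ℂ)+2) * (z-2) = -2 := by linear_combination hlin
  have hA : ((m:ℂ)+2)^(m+2) * (z^(m+1)*(z-2)) = (2*(m+1))^(m+1) * (-2) := by
    rw [← hlin, ← hl2, mul_pow]; ring
  have hB : (((m:ℂ)+2)^(m+2))^2 = ((2*(m+1))^(m+1))^2 := by
    have : (((m:ℂ)+2)^(m+2) * (z^(m+1)*(z-2)))^2 = ((2*((m:ℂ)+1))^(m+1) * (-2))^2 := by rw [hA]
    linear_combination (1/4) * this - (1/4) * (((m:ℂ)+2)^(m+2))^2 * h1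
  have hN : ((m+2)^(m+2))^2 = ((2*(m+1))^(m+1))^2 := by exact_mod_cast hB
  exact nat_ne (m+1) hn (Nat.pow_left_injective (n := 2) (by norm_num) hN).symm

open Polynomial in
lemma qp_card (n : ℕ) (hn : 1 ≤ n) : (qp n).roots.toFinset.card = 2*n+2 := by
  have h0 : qp n ≠ 0 := by
    intro h
    have := qp_deg n
    rw [h] at this
    simp at this
  have nd : (qp n).roots.Nodup := by
    rw [Multiset.nodup_iff_count_le_one]
    intro z
    rw [count_roots]
    by_contra hc
    obtain ⟨a, b⟩ := (one_lt_rootMultiplicity_iff_isRoot h0).mp (not_le.mp hc)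
    exact qp_no_double n hn z a b
  rw [Multiset.toFinset_card_of_nodup nd, ← qp_deg n]
  exact (IsAlgClosed.splits (qp n)).natDegree_eq_card_roots.symm

/-! ### Assembling the left eigenbasis -/

/-- index type of the left eigenbasis -/
abbrev Idx (n : ℕ) : Type := {z : ℂ // z ∈ (qp n).roots.toFinset} ⊕ Fin 2

/-- the left eigenbasis -/
noncomputable def ev (n : ℕ) (hn : 1 ≤ n) : Idx n → (Fin (2*n+4) → ℂ) :=
  Sum.elim (fun z => wv n z.1 (z.1^n*(z.1-2)/2)) ![k1 n hn, k2 n hn]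

/-- the eigenvalues -/
noncomputable def mu (n : ℕ) : Idx n → ℂ := Sum.elim (fun z => z.1) (fun _ => 0)

lemma root_sq {n : ℕ} (z : {z : ℂ // z ∈ (qp n).roots.toFinset}) :
    (z.1^n*(z.1-2))^2 = 4 := by
  have h := z.2
  rw [Multiset.mem_toFinset] at h
  have h1 := (Polynomial.isRoot_of_mem_roots h)
  unfold qp at h1
  simp only [Polynomial.IsRoot.def, Polynomial.eval_sub, Polynomial.eval_pow, Polynomial.eval_mul,
    Polynomial.eval_X, Polynomial.eval_C] at h1
  linear_combination h1

lemma root_ne {n : ℕ} (hn : 1 ≤ n) (z : {z : ℂ // z ∈ (qp n).roots.toFinset}) : z.1 ≠ 0 := by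
  intro h
  have h1 := root_sq z
  rw [h, zero_pow (by omega)] at h1
  norm_num at h1

lemma ev_eig {n : ℕ} (hn : 1 ≤ n) {κ : ℝ} (hκ : κ ∈ Set.Ioo (0 : ℝ) (1/2))
    (heq : (2 + 2*κ)^n * κ = 1) (k : Idx n) :
    ev n hn k ᵥ* Amat n κ = mu n k • ev n hn k := by
  rcases k with z | k
  · simp only [ev, mu, Sum.elim_inl]
    have := root_sq z
    exact left_eig hn hκ heq (root_ne hn z) (by linear_combination (1/4) * this) (by ring)
  · simp only [ev, mu, Sum.elim_inr, zero_smul]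
    fin_cases k
    · exact k1_ker hn hκ heq
    · exact k2_ker hn hκ heq

lemma k12_li (n : ℕ) (hn : 1 ≤ n) : LinearIndependent ℂ ![k1 n hn, k2 n hn] := by
  rw [LinearIndependent.pair_iff]
  intro s t h
  have a := congrFun h ⟨n, by omega⟩
  have b := congrFun h (Fin.rev ⟨n, by omega⟩)
  have e1 : (⟨n, by omega⟩ : Fin (2*n+4)) ≠ ⟨n-1, by omega⟩ := by
    intro h; have := congrArg Fin.val h; simp only at this; omega
  have e2 : (⟨n, by omega⟩ : Fin (2*n+4)) ≠ Fin.rev ⟨n-1, by omega⟩ := by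
    intro h; have := congrArg Fin.val h; simp only [rev_val] at this; omega
  have e3 : (⟨n, by omega⟩ : Fin (2*n+4)) ≠ Fin.rev ⟨n, by omega⟩ := by
    intro h; have := congrArg Fin.val h; simp only [rev_val] at this; omega
  have e4 : (Fin.rev ⟨n, by omega⟩ : Fin (2*n+4)) ≠ Fin.rev ⟨n-1, by omega⟩ :=
    fun h => e1 (Fin.rev_injective h)
  have e5 : (Fin.rev ⟨n, by omega⟩ : Fin (2*n+4)) ≠ ⟨n-1, by omega⟩ := by
    intro h; have := congrArg Fin.val h; simp only [rev_val] at this; omega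
  simp only [k1, k2, Pi.add_apply, Pi.smul_apply, Pi.sub_apply, Pi.single_eq_same,
    Pi.single_eq_of_ne e1, Pi.single_eq_of_ne e2, Pi.single_eq_of_ne e3, Pi.single_eq_of_ne e4,
    Pi.single_eq_of_ne e5, Pi.single_eq_of_ne e3.symm, Pi.zero_apply, smul_eq_mul] at a b
  constructor
  · linear_combination -a
  · linear_combination -b

lemma ev_li {n : ℕ} (hn : 1 ≤ n) {κ : ℝ} (hκ : κ ∈ Set.Ioo (0 : ℝ) (1/2))
    (heq : (2 + 2*κ)^n * κ = 1) : LinearIndependent ℂ (ev n hn) := by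
  let f : Module.End ℂ (Fin (2*n+4) → ℂ) := (Amat n κ).vecMulLinear
  have hE : ∀ k, ev n hn k ∈ f.eigenspace (mu n k) := by
    intro k
    rw [Module.End.mem_eigenspace_iff]
    exact ev_eig hn hκ heq k
  unfold ev
  apply LinearIndependent.sum_type
  · refine Module.End.eigenvectors_linearIndependent' f (fun z => z.1) Subtype.val_injective _ ?_
    intro z
    exact ⟨hE (Sum.inl z), wv_ne _ _⟩
  · exact k12_li n hn
  · have hd := (Module.End.eigenspaces_iSupIndep f) 0
    refine (hd.mono ?_ ?_).symm
    · rw [Submodule.span_le]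
      rintro _ ⟨k, rfl⟩
      exact hE (Sum.inr k)
    · rw [Submodule.span_le]
      rintro _ ⟨z, rfl⟩
      have h1 : f.eigenspace z.1 ≤ ⨆ j, ⨆ (_ : j ≠ 0), f.eigenspace j :=
        le_iSup₂_of_le z.1 (root_ne hn z) le_rfl
      exact h1 (hE (Sum.inl z))

lemma idx_card (n : ℕ) (hn : 1 ≤ n) : Fintype.card (Idx n) = 2*n+4 := by
  rw [Fintype.card_sum, Fintype.card_coe, qp_card n hn, Fintype.card_fin]

lemma diag_part {n : ℕ} (hn : 1 ≤ n) {κ : ℝ} (hκ : κ ∈ Set.Ioo (0 : ℝ) (1/2))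
    (heq : (2 + 2*κ)^n * κ = 1) :
    ∃ (σ : Fin (2*n+4) ≃ Idx n) (Q : Matrix (Fin (2*n+4)) (Fin (2*n+4)) ℂ),
      IsUnit Q ∧ (∀ i, Q i = ev n hn (σ i)) ∧
      Q * Amat n κ = Matrix.diagonal (fun i => mu n (σ i)) * Q := by
  let σ : Fin (2*n+4) ≃ Idx n := (Fintype.equivFinOfCardEq (idx_card n hn)).symm
  refine ⟨σ, Matrix.of fun i => ev n hn (σ i), ?_, fun i => rfl, ?_⟩
  · rw [← Matrix.linearIndependent_rows_iff_isUnit]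
    exact (ev_li hn hκ heq).comp σ σ.injective
  · ext i j
    rw [Matrix.diagonal_mul]
    exact congrFun (ev_eig hn hκ heq (σ i)) j

lemma ker_zero {n : ℕ} (hn : 1 ≤ n) {κ : ℝ} (hκ : κ ∈ Set.Ioo (0 : ℝ) (1/2))
    (heq : (2 + 2*κ)^n * κ = 1) (v : Fin (2*n+4) → ℂ) (hv : (Amat n κ).mulVec v = 0)
    (h1 : k1 n hn ⬝ᵥ v = 0) (h2 : k2 n hn ⬝ᵥ v = 0) : v = 0 := by
  obtain ⟨σ, Q, hQ, hrow, -⟩ := diag_part hn hκ heq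
  have key : ∀ k, ev n hn k ⬝ᵥ v = 0 := by
    rintro (z | k)
    · have a := ev_eig hn hκ heq (Sum.inl z)
      have b := congrArg (fun w => w ⬝ᵥ v) a
      simp only [← Matrix.dotProduct_mulVec, hv, dotProduct_zero, smul_dotProduct] at b
      exact (smul_eq_zero.mp b.symm).resolve_left (root_ne hn z)
    · fin_cases k
      · exact h1
      · exact h2
  have hQv : Q.mulVec v = 0 := by
    ext i
    simp only [Matrix.mulVec, Pi.zero_apply]
    rw [hrow i]; exact key _
  have inj := Matrix.mulVec_injective_of_isUnit hQ
  exact inj (by rw [hQv, Matrix.mulVec_zero])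

lemma k1_dot {n : ℕ} (hn : 1 ≤ n) (v : Fin (2*n+4) → ℂ) :
    k1 n hn ⬝ᵥ v = v ⟨n-1, by omega⟩ - v ⟨n, by omega⟩ := by
  simp [k1, sub_dotProduct]

lemma k2_dot {n : ℕ} (hn : 1 ≤ n) (v : Fin (2*n+4) → ℂ) :
    k2 n hn ⬝ᵥ v = v (Fin.rev ⟨n-1, by omega⟩) - v (Fin.rev ⟨n, by omega⟩) := by
  simp [k2, sub_dotProduct]

lemma kv_vals {n : ℕ} (hn : 1 ≤ n) :
    kerVec n ⟨n-1, by omega⟩ = 1 ∧ kerVec n ⟨n, by omega⟩ = -1 ∧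
    kerVec n (Fin.rev ⟨n-1, by omega⟩) = 0 ∧ kerVec n (Fin.rev ⟨n, by omega⟩) = 0 := by
  unfold kerVec
  simp only [rev_val]
  refine ⟨?_, ?_, ?_, ?_⟩
  · rw [if_pos (by omega)]
  · rw [if_neg (by omega), if_pos (by omega)]
  · rw [if_neg (by omega), if_neg (by omega)]
  · rw [if_neg (by omega), if_neg (by omega)]

/-- For every `n ≥ 1`: `A_n` is diagonalizable over `ℂ`, and its kernel is
two-dimensional, spanned by `v₁ + J_n v₁` and `v₁ - J_n v₁`, where
`v₁ = e_1 + ⋯ + e_n - e_{n+1} - e_{n+2}`. -/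
theorem Amat_diagonalizable_kernel (n : ℕ) (hn : 1 ≤ n) (κ : ℝ)
    (hκ : κ ∈ Set.Ioo (0 : ℝ) (1/2)) (heq : (2 + 2*κ)^n * κ = 1) :
    (∃ P D : Matrix (Fin (2*n + 4)) (Fin (2*n + 4)) ℂ,
      IsUnit P ∧ D.IsDiag ∧ Amat n κ = P * D * P⁻¹) ∧
    LinearMap.ker (Amat n κ).mulVecLin =
      Submodule.span ℂ {kerVec n + (Jmat n).mulVec (kerVec n),
                        kerVec n - (Jmat n).mulVec (kerVec n)} ∧
    LinearIndependent ℂ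
      ![kerVec n + (Jmat n).mulVec (kerVec n),
        kerVec n - (Jmat n).mulVec (kerVec n)] := by
  obtain ⟨q1, q2, q3, q4⟩ := kv_vals hn
  have r1 := right_ker hn hκ heq
  have r2 := right_ker_J hn hκ heq
  have j1 : ∀ i, (Jmat n).mulVec (kerVec n) i = kerVec n (Fin.rev i) := fun i => by rw [Jv]
  refine ⟨?_, ?_, ?_⟩
  · obtain ⟨σ, Q, hQ, -, hQA⟩ := diag_part hn hκ heq
    have hdet : IsUnit Q.det := (Matrix.isUnit_iff_isUnit_det Q).mp hQ
    refine ⟨Q⁻¹, Matrix.diagonal (fun i => mu n (σ i)), ?_, Matrix.isDiag_diagonal _, ?_⟩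
    · rw [Matrix.isUnit_nonsing_inv_iff]; exact hQ
    · rw [Matrix.nonsing_inv_nonsing_inv Q hdet, Matrix.mul_assoc, ← hQA, ← Matrix.mul_assoc,
        Matrix.nonsing_inv_mul Q hdet, Matrix.one_mul]
  · apply le_antisymm
    · intro v hv
      rw [LinearMap.mem_ker, Matrix.mulVecLin_apply] at hv
      rw [Submodule.mem_span_pair]
      set a := (k1 n hn ⬝ᵥ v) / 2 with ha
      set b := (k2 n hn ⬝ᵥ v) / 2 with hb
      refine ⟨(a+b)/2, (a-b)/2, ?_⟩
      have hz : v - (a • kerVec n + b • (Jmat n).mulVec (kerVec n)) = 0 := by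
        apply ker_zero hn hκ heq
        · rw [Matrix.mulVec_sub, Matrix.mulVec_add, Matrix.mulVec_smul, Matrix.mulVec_smul,
            hv, r1, r2]
          simp
        · rw [k1_dot] at ha ⊢
          simp only [Pi.sub_apply, Pi.add_apply, Pi.smul_apply, smul_eq_mul, j1, q1, q2, q3, q4]
          linear_combination -2 * ha
        · rw [k2_dot] at hb ⊢
          simp only [Pi.sub_apply, Pi.add_apply, Pi.smul_apply, smul_eq_mul, j1, q1, q2, q3, q4,
            Fin.rev_rev]
          linear_combination -2 * hb
      rw [sub_eq_zero.mp hz]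
      module
    · rw [Submodule.span_le]
      rintro _ (rfl | rfl)
      · simp only [SetLike.mem_coe, LinearMap.mem_ker, Matrix.mulVecLin_apply, Matrix.mulVec_add,
          r1, r2, add_zero]
      · simp only [SetLike.mem_coe, LinearMap.mem_ker, Matrix.mulVecLin_apply, Matrix.mulVec_sub,
          r1, r2, sub_zero]
  · rw [LinearIndependent.pair_iff]
    intro s t h
    have a := congrFun h ⟨n, by omega⟩
    have b := congrFun h (Fin.rev ⟨n, by omega⟩)
    simp only [Pi.add_apply, Pi.sub_apply, Pi.smul_apply, smul_eq_mul, j1, q2, q4, Fin.rev_rev,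
      Pi.zero_apply] at a b
    constructor
    · linear_combination (-1/2) * a - (1/2) * b
    · linear_combination (-1/2) * a + (1/2) * b
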